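/- Let O⊆ℂ be an open connected set, n≥1, and let Φ(t,ξ)=Σ_{|α|≤m} c_α(t)·ξ^α be a polynomial in ξ∈ℝⁿ whose coefficients c_α are analytic functions on O. Then for every compact set K⊆O there exists ν∈ℕ such that for every ξ∈ℝⁿ, either the function t↦Φ(t,ξ) is identically zero on O, or it has at most ν zeros in K counted with multiplicity. -/

import Mathlib

/-- The vanishing order of `f` at `z`: the order of the first nonvanishing term of the
power series expansion of `f` at `z`, i.e. the least `m` with `f⁽ᵐ⁾(z) ≠ 0`. -/
noncomputable def vanishingOrder (f : ℂ → ℂ) (z : ℂ) : ℕ :=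
  sInf {m : ℕ | iteratedDeriv m f z ≠ 0}

open Filter Topology Metric

/-- Two linear maps out of a common space with `ker A ≤ ker B` and `A` of finite rank satisfy
`‖B x‖ ≤ M ‖A x‖` for some constant `M`. -/
theorem LinearMap.exists_norm_le_mul_norm_of_ker_le {V E F : Type*} [AddCommGroup V] [Module ℂ V]
    [FiniteDimensional ℂ V] [NormedAddCommGroup E] [NormedSpace ℂ E] [NormedAddCommGroup F]
    [NormedSpace ℂ F] (A : V →ₗ[ℂ] E) (B : V →ₗ[ℂ] F)
    (h : LinearMap.ker A ≤ LinearMap.ker B) : ∃ M : ℝ, ∀ x, ‖B x‖ ≤ M * ‖A x‖ := by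
  obtain ⟨g, hg⟩ := A.rangeRestrict.exists_rightInverse_of_surjective A.range_rangeRestrict
  let G := LinearMap.toContinuousLinearMap (B ∘ₗ g)
  refine ⟨‖G‖, fun x => ?_⟩
  have hx : x - g (A.rangeRestrict x) ∈ LinearMap.ker A := by
    have : A (g (A.rangeRestrict x)) = A x :=
      congrArg Subtype.val (LinearMap.congr_fun hg (A.rangeRestrict x))
    rw [LinearMap.mem_ker, map_sub, this, sub_self]
  have hB : B x = G (A.rangeRestrict x) := by
    have := LinearMap.mem_ker.1 (h hx)
    rw [map_sub, sub_eq_zero] at this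
    exact this
  rw [hB]
  exact G.le_opNorm _

/-- A holomorphic function vanishing to order at least `m` at `a` is globally divisible
by `(t - a) ^ m`. -/
theorem DifferentiableOn.exists_eq_pow_mul {O : Set ℂ} (hO : IsOpen O) {f : ℂ → ℂ}
    (hf : DifferentiableOn ℂ f O) {a : ℂ} (ha : a ∈ O) {m : ℕ}
    (hm : (m : ℕ∞) ≤ analyticOrderAt f a) :
    ∃ g : ℂ → ℂ, DifferentiableOn ℂ g O ∧ ∀ t, f t = (t - a) ^ m * g t := by
  obtain ⟨g₀, hg₀, hfg⟩ :=
    (natCast_le_analyticOrderAt (hf.analyticAt (hO.mem_nhds ha))).1 hm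
  let g : ℂ → ℂ := fun t => if t = a then g₀ a else f t / (t - a) ^ m
  have hgg : g =ᶠ[𝓝 a] g₀ := by
    filter_upwards [hfg] with t ht
    by_cases hta : t = a
    · simp [g, hta]
    · have : (t - a) ^ m ≠ 0 := pow_ne_zero _ (sub_ne_zero.2 hta)
      simp only [g, if_neg hta, ht, smul_eq_mul]
      field_simp
  refine ⟨g, fun t ht => ?_, fun t => ?_⟩
  · by_cases hta : t = a
    · subst hta
      exact (hg₀.differentiableAt.congr_of_eventuallyEq hgg).differentiableWithinAt
    · have hq : DifferentiableAt ℂ (fun t => f t / (t - a) ^ m) t :=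
        (hf.differentiableAt (hO.mem_nhds ht)).fun_div (by fun_prop)
          (pow_ne_zero _ (sub_ne_zero.2 hta))
      refine (hq.congr_of_eventuallyEq ?_).differentiableWithinAt
      filter_upwards [isOpen_ne.mem_nhds hta] with s hs
      simp only [g, if_neg hs]
  · by_cases hta : t = a
    · subst hta
      simpa [g] using hfg.self_of_nhds
    · have : (t - a) ^ m ≠ 0 := pow_ne_zero _ (sub_ne_zero.2 hta)
      simp only [g, if_neg hta]
      field_simp

/-- Finitely many zeros of a holomorphic function can be factored out simultaneously. -/
theorem DifferentiableOn.exists_eq_prod_pow_mul {O : Set ℂ} (hO : IsOpen O) {f : ℂ → ℂ}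
    (hf : DifferentiableOn ℂ f O) (m : ℂ → ℕ) (S : Finset ℂ) (hS : ↑S ⊆ O)
    (hm : ∀ z ∈ S, (m z : ℕ∞) ≤ analyticOrderAt f z) :
    ∃ g : ℂ → ℂ, DifferentiableOn ℂ g O ∧ ∀ t, f t = (∏ z ∈ S, (t - z) ^ m z) * g t := by
  classical
  induction S using Finset.induction_on with
  | empty => exact ⟨f, hf, by simp⟩
  | insert a S haS ih =>
    obtain ⟨g, hg, hfg⟩ := ih (fun z hz => hS (by simp_all))
      (fun z hz => hm z (Finset.mem_insert_of_mem hz))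
    have ha : a ∈ O := hS (by simp)
    have hP : AnalyticAt ℂ (fun t : ℂ => ∏ z ∈ S, (t - z) ^ m z) a :=
      Finset.analyticAt_fun_prod _ fun z _ => by fun_prop
    have hP0 : analyticOrderAt (fun t : ℂ => ∏ z ∈ S, (t - z) ^ m z) a = 0 := by
      rw [hP.analyticOrderAt_eq_zero]
      refine Finset.prod_ne_zero_iff.2 fun z hz => pow_ne_zero _ (sub_ne_zero.2 ?_)
      rintro rfl
      exact haS hz
    have hord : analyticOrderAt f a = analyticOrderAt g a := by
      have : f = (fun t : ℂ => ∏ z ∈ S, (t - z) ^ m z) * g := funext hfg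
      rw [this, analyticOrderAt_mul hP (hg.analyticAt (hO.mem_nhds ha)), hP0, zero_add]
    obtain ⟨h, hh, hgh⟩ := hg.exists_eq_pow_mul hO ha
      (hord ▸ hm a (Finset.mem_insert_self a S))
    refine ⟨h, hh, fun t => ?_⟩
    rw [hfg, hgh, Finset.prod_insert haS]
    ring

theorem vanishingOrder_le_analyticOrderAt {f : ℂ → ℂ} {z : ℂ} (hf : AnalyticAt ℂ f z) :
    (vanishingOrder f z : ℕ∞) ≤ analyticOrderAt f z := by
  rw [natCast_le_analyticOrderAt_iff_iteratedDeriv_eq_zero hf]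
  intro i hi
  simpa using Nat.notMem_of_lt_sInf hi

/-- A quantitative Schwarz lemma: zeros in the disc of radius `r`, of total multiplicity `N`,
force a holomorphic function to be smaller by a factor `2 ^ N` there than on the disc of
radius `5 * r`. -/
theorem DifferentiableOn.norm_mul_two_pow_le {O : Set ℂ} (hO : IsOpen O) {f : ℂ → ℂ}
    (hf : DifferentiableOn ℂ f O) {z₀ : ℂ} {r : ℝ} (hr : 0 < r)
    (hball : closedBall z₀ (5 * r) ⊆ O) {C : ℝ} (hC : ∀ t ∈ closedBall z₀ (5 * r), ‖f t‖ ≤ C)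
    (m : ℂ → ℕ) (S : Finset ℂ) (hS : ↑S ⊆ closedBall z₀ r)
    (hm : ∀ z ∈ S, (m z : ℕ∞) ≤ analyticOrderAt f z) {t : ℂ} (ht : t ∈ closedBall z₀ r) :
    ‖f t‖ * 2 ^ (∑ z ∈ S, m z) ≤ C := by
  have hsub : closedBall z₀ r ⊆ closedBall z₀ (5 * r) := closedBall_subset_closedBall (by linarith)
  obtain ⟨g, hg, hfg⟩ := hf.exists_eq_prod_pow_mul hO m S (hS.trans (hsub.trans hball)) hm
  set N := ∑ z ∈ S, m z with hN
  have hR : (5 * r) ≠ 0 := by positivity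
  have hgt : ‖g t‖ ≤ C / (4 * r) ^ N := by
    refine Complex.norm_le_of_forall_mem_frontier_norm_le (U := ball z₀ (5 * r)) isBounded_ball
      ((hg.mono (by rwa [closure_ball _ hR])).diffContOnCl) (fun w hw => ?_)
      (by rw [closure_ball _ hR]; exact hsub ht)
    rw [frontier_ball _ hR] at hw
    rw [le_div_iff₀ (by positivity)]
    have hlow : (4 * r) ^ N ≤ ‖∏ z ∈ S, (w - z) ^ m z‖ := by
      rw [hN, ← Finset.prod_pow_eq_pow_sum, norm_prod]
      refine Finset.prod_le_prod (fun _ _ => by positivity) fun z hz => ?_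
      rw [norm_pow]
      refine pow_le_pow_left₀ (by positivity) ?_ _
      have h1 := mem_closedBall.1 (hS hz)
      have h2 := mem_sphere.1 hw
      have h3 := dist_triangle w z z₀
      rw [← dist_eq_norm]
      linarith
    calc ‖g w‖ * (4 * r) ^ N ≤ ‖g w‖ * ‖∏ z ∈ S, (w - z) ^ m z‖ := by gcongr
      _ = ‖f w‖ := by rw [hfg w, norm_mul, mul_comm]
      _ ≤ C := hC w (sphere_subset_closedBall hw)
  have hup : ‖∏ z ∈ S, (t - z) ^ m z‖ ≤ (2 * r) ^ N := by
    rw [hN, ← Finset.prod_pow_eq_pow_sum, norm_prod]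
    refine Finset.prod_le_prod (fun _ _ => by positivity) fun z hz => ?_
    rw [norm_pow]
    refine pow_le_pow_left₀ (by positivity) ?_ _
    have h1 := mem_closedBall.1 (hS hz)
    have h2 := mem_closedBall.1 ht
    have h3 := dist_triangle_right t z z₀
    rw [← dist_eq_norm]
    linarith
  calc ‖f t‖ * 2 ^ N = ‖∏ z ∈ S, (t - z) ^ m z‖ * ‖g t‖ * 2 ^ N := by rw [hfg t, norm_mul]
    _ ≤ (2 * r) ^ N * (C / (4 * r) ^ N) * 2 ^ N := by gcongr
    _ = C := by
      rw [show 4 * r = 2 * r * 2 by ring, mul_pow (2 * r)]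
      field_simp

/-- The nonzero linear combinations of finitely many holomorphic functions on a connected open set
have a uniformly bounded number of zeros on a small disc. -/
theorem exists_sum_vanishingOrder_le_of_closedBall {O : Set ℂ} (hO : IsOpen O)
    (hOconn : IsPreconnected O) {d : ℕ} {c : Fin d → ℂ → ℂ}
    (hc : ∀ i, DifferentiableOn ℂ (c i) O) {z₀ : ℂ} {r : ℝ} (hr : 0 < r)
    (hball : closedBall z₀ (5 * r) ⊆ O) :
    ∃ ν : ℕ, ∀ a : Fin d → ℂ, (∀ t ∈ O, ∑ i, c i t * a i = 0) ∨
      ∀ S : Finset ℂ, ↑S ⊆ closedBall z₀ r →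
        ∑ z ∈ S, vanishingOrder (fun t => ∑ i, c i t * a i) z ≤ ν := by
  have hsub : closedBall z₀ r ⊆ closedBall z₀ (5 * r) := closedBall_subset_closedBall (by linarith)
  let L (s : Set ℂ) (hs : s ⊆ O) : (Fin d → ℂ) →ₗ[ℂ] C(s, ℂ) :=
    Fintype.linearCombination ℂ
      fun i => ⟨s.domRestrict (c i), ((hc i).continuousOn.mono hs).domRestrict⟩
  have hL (s : Set ℂ) (hs : s ⊆ O) (a : Fin d → ℂ) (t : s) :
      L s hs a t = ∑ i, c i t * a i := by
    simp only [L, Fintype.linearCombination_apply, ContinuousMap.sum_apply,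
      ContinuousMap.smul_apply, smul_eq_mul]
    exact Finset.sum_congr rfl fun i _ => mul_comm _ _
  have hf (a : Fin d → ℂ) : DifferentiableOn ℂ (fun t => ∑ i, c i t * a i) O :=
    DifferentiableOn.fun_sum fun i _ => (hc i).mul_const _
  have hzero (a : Fin d → ℂ) (ha : L _ (hsub.trans hball) a = 0) :
      ∀ t ∈ O, ∑ i, c i t * a i = 0 := by
    refine AnalyticOnNhd.eqOn_zero_of_preconnected_of_eventuallyEq_zero
      ((hf a).analyticOnNhd hO) hOconn (hball (mem_closedBall_self (by positivity))) ?_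
    filter_upwards [closedBall_mem_nhds z₀ hr] with t ht
    simpa [ha] using (hL _ (hsub.trans hball) a ⟨t, ht⟩).symm
  obtain ⟨M, hM⟩ := (L _ (hsub.trans hball)).exists_norm_le_mul_norm_of_ker_le (L _ hball) (by
    intro a ha
    ext t
    rw [hL _ hball, hzero a ha t (hball t.2)]
    rfl)
  obtain ⟨ν, hν⟩ := exists_nat_ge M
  refine ⟨ν, fun a => or_iff_not_imp_left.2 fun hne S hS => ?_⟩
  have hpos : 0 < ‖L _ (hsub.trans hball) a‖ := norm_pos_iff.2 fun h => hne (hzero a h)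
  set N := ∑ z ∈ S, vanishingOrder (fun t => ∑ i, c i t * a i) z
  have hbound : ‖L _ (hsub.trans hball) a‖ ≤ ‖L _ hball a‖ / 2 ^ N := by
    refine (ContinuousMap.norm_le _ (by positivity)).2 fun t => ?_
    rw [le_div_iff₀ (by positivity), hL _ (hsub.trans hball)]
    refine (hf a).norm_mul_two_pow_le hO hr hball (fun w hw => ?_) _ S hS (fun z hz => ?_) t.2
    · rw [← hL _ hball a ⟨w, hw⟩]
      exact ContinuousMap.norm_coe_le_norm _ _
    · exact vanishingOrder_le_analyticOrderAt
        ((hf a).analyticAt (hO.mem_nhds (hball (hsub (hS hz)))))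
  rw [le_div_iff₀ (by positivity)] at hbound
  have h2 : (2 : ℝ) ^ N ≤ M :=
    le_of_mul_le_mul_left ((hbound.trans (hM a)).trans_eq (mul_comm _ _)) hpos
  have h3 : (N : ℝ) ≤ 2 ^ N := by exact_mod_cast Nat.lt_two_pow_self.le
  exact_mod_cast h3.trans (h2.trans hν)

/-- The nonzero linear combinations of finitely many holomorphic functions on a connected open set
have a uniformly bounded number of zeros on a compact set. -/
theorem exists_sum_vanishingOrder_le_of_isCompact {O : Set ℂ} (hO : IsOpen O)
    (hOconn : IsPreconnected O) {d : ℕ} {c : Fin d → ℂ → ℂ}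
    (hc : ∀ i, DifferentiableOn ℂ (c i) O) {K : Set ℂ} (hK : IsCompact K) (hKO : K ⊆ O) :
    ∃ ν : ℕ, ∀ a : Fin d → ℂ, (∀ t ∈ O, ∑ i, c i t * a i = 0) ∨
      ∀ S : Finset ℂ, ↑S ⊆ K →
        ∑ z ∈ S, vanishingOrder (fun t => ∑ i, c i t * a i) z ≤ ν := by
  classical
  refine hK.induction_on (p := fun K => ∃ ν : ℕ, ∀ a : Fin d → ℂ,
    (∀ t ∈ O, ∑ i, c i t * a i = 0) ∨ ∀ S : Finset ℂ, ↑S ⊆ K →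
      ∑ z ∈ S, vanishingOrder (fun t => ∑ i, c i t * a i) z ≤ ν) ?_ ?_ ?_ ?_
  · refine ⟨0, fun a => Or.inr fun S hS => ?_⟩
    simp [Finset.coe_eq_empty.1 (Set.subset_empty_iff.1 hS)]
  · rintro s t hst ⟨ν, hν⟩
    exact ⟨ν, fun a => (hν a).imp_right fun h S hS => h S (hS.trans hst)⟩
  · rintro s t ⟨ν, hν⟩ ⟨μ, hμ⟩
    refine ⟨ν + μ, fun a => ?_⟩
    rcases hν a with h | hs
    · exact Or.inl h
    rcases hμ a with h | ht
    · exact Or.inl h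
    refine Or.inr fun S hS => ?_
    rw [← Finset.sum_filter_add_sum_filter_not S (· ∈ s)]
    refine add_le_add (hs _ fun z hz => (Finset.mem_filter.1 hz).2) (ht _ fun z hz => ?_)
    have hz' := Finset.mem_filter.1 hz
    exact (hS hz'.1).resolve_left hz'.2
  · intro z hz
    obtain ⟨R, hR, hball⟩ := nhds_basis_closedBall.mem_iff.1 (hO.mem_nhds (hKO hz))
    have hr : 0 < R / 5 := by positivity
    exact ⟨closedBall z (R / 5), mem_nhdsWithin_of_mem_nhds (closedBall_mem_nhds z hr),
      exists_sum_vanishingOrder_le_of_closedBall hO hOconn hc hr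
        (by rwa [mul_div_cancel₀ R (by norm_num : (5 : ℝ) ≠ 0)])⟩

/-- Let `Φ(t,ξ) = Σ_{|α|≤m} c_α(t) ξ^α` be a polynomial in `ξ ∈ ℝⁿ` (written as a finite
sum of `d` monomials with exponents `e i` of total degree `≤ m`) whose coefficients are
analytic on an open connected `O ⊆ ℂ`. Then for each compact `K ⊆ O` there is `ν` such that
for every `ξ`, `t ↦ Φ(t,ξ)` is identically zero on `O` or has at most `ν` zeros in `K`
counted with multiplicity. -/
theorem stmt_4 (O : Set ℂ) (hO : IsOpen O) (hOconn : IsConnected O)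
    (n : ℕ) (hn : 1 ≤ n) (m : ℕ) (d : ℕ)
    (e : Fin d → Fin n → ℕ) (c : Fin d → ℂ → ℂ)
    (he : ∀ i, (∑ k, e i k) ≤ m)
    (hc : ∀ i, DifferentiableOn ℂ (c i) O)
    (K : Set ℂ) (hK : IsCompact K) (hKO : K ⊆ O) :
    ∃ ν : ℕ, ∀ ξ : EuclideanSpace ℝ (Fin n),
      (∀ t ∈ O, ∑ i, c i t * ((∏ k, ξ k ^ e i k : ℝ) : ℂ) = 0) ∨
      (∀ S : Finset ℂ, ↑S ⊆ K →
        (∀ z ∈ S, ∑ i, c i z * ((∏ k, ξ k ^ e i k : ℝ) : ℂ) = 0) →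
        ∑ z ∈ S, vanishingOrder (fun t => ∑ i, c i t * ((∏ k, ξ k ^ e i k : ℝ) : ℂ)) z ≤ ν) := by
  obtain ⟨ν, hν⟩ :=
    exists_sum_vanishingOrder_le_of_isCompact hO hOconn.isPreconnected hc hK hKO
  exact ⟨ν, fun ξ => (hν fun i => ((∏ k, ξ k ^ e i k : ℝ) : ℂ)).imp_right
    fun h S hS _ => h S hS⟩
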